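/- Brzozowski's construction of the state-minimal DFA: let N be a relational NFA over Σ with finitely many states and L := L(N). Let D₁ be the reachable subset construction of rev N (a DFA whose states are the sets (rev N)_u[F_N] for words u, with transitions S ↦ (rev N)_a[S], initial state F_N, and final states those meeting I_N), and let D₂ be the reachable subset construction of rev D₁. Then D₂ accepts L, distinct states of D₂ accept distinct languages, and the map sending each state of D₂ to the language it accepts is a DFA isomorphism from D₂ onto the state-minimal DFA of L, namely the DFA whose states are the left word quotients {u⁻¹L : u a word}, with initial state L, a-transitions X ↦ a⁻¹X, and final states {X : ε ∈ X}. -/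

import Mathlib

/-- A relational nondeterministic finite automaton over alphabet `σ` with states `Z`. -/
structure RelNFA (σ : Type*) (Z : Type*) where
  /-- initial states -/
  I : Set Z
  /-- final states -/
  F : Set Z
  /-- for each letter, a transition relation -/
  tr : σ → Z → Z → Prop

namespace RelNFA

variable {σ Z : Type*}

/-- `N_w`: the transition relation of the word `w`, with `N_ε` the identity
relation and `N_{u·a} = N_u ; N_a`. -/
def runRel (N : RelNFA σ Z) (w : List σ) : Z → Z → Prop :=
  w.foldl (fun R a => fun z z' => ∃ y, R z y ∧ N.tr a y z') Eq

/-- `N_w[S]`: the relational image of a set of states. -/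
def imgSet (N : RelNFA σ Z) (w : List σ) (S : Set Z) : Set Z :=
  {z' | ∃ z ∈ S, N.runRel w z z'}

/-- The language accepted by `N`: `{w : N_w[I] ∩ F ≠ ∅}`. -/
def lang (N : RelNFA σ Z) : Set (List σ) :=
  {w | (N.imgSet w N.I ∩ N.F).Nonempty}

/-- `L(N_{@z})`: the language accepted by `N` with initial states `{z}`. -/
def langFrom (N : RelNFA σ Z) (z : Z) : Set (List σ) :=
  {w | (N.imgSet w {z} ∩ N.F).Nonempty}

/-- The reverse nfa: swap initial and final states and take converse transitions. -/
def rev (N : RelNFA σ Z) : RelNFA σ Z where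
  I := N.F
  F := N.I
  tr := fun a z z' => N.tr a z' z

end RelNFA

namespace RelNFA

variable {σ Z : Type*}

theorem runRel_nil (N : RelNFA σ Z) : N.runRel [] = Eq := rfl

theorem runRel_append_singleton (N : RelNFA σ Z) (u : List σ) (a : σ) (z z' : Z) :
    N.runRel (u ++ [a]) z z' ↔ ∃ y, N.runRel u z y ∧ N.tr a y z' := by
  simp [RelNFA.runRel, List.foldl_append]

theorem imgSet_nil (N : RelNFA σ Z) (S : Set Z) : N.imgSet [] S = S := by
  ext z
  simp [RelNFA.imgSet, RelNFA.runRel]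

theorem imgSet_append_singleton (N : RelNFA σ Z) (u : List σ) (a : σ) (S : Set Z) :
    N.imgSet (u ++ [a]) S = {z' | ∃ z ∈ N.imgSet u S, N.tr a z z'} := by
  ext z'
  simp only [RelNFA.imgSet, Set.mem_setOf_eq, runRel_append_singleton]
  tauto

end RelNFA

/-- Deterministic automata with state type `Q`. -/
structure DetAut (σ : Type*) (Q : Type*) where
  /-- the initial state -/
  init : Q
  /-- deterministic transitions -/
  next : σ → Q → Q
  /-- accepting states -/
  acc : Set Q

/-- The state reached from `q` after reading the word `w`. -/
def dfaRun {σ Q : Type*} (D : DetAut σ Q) (w : List σ) (q : Q) : Q :=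
  w.foldl (fun q a => D.next a q) q

/-- The language accepted by `D` started in state `q`. -/
def dfaLangFrom {σ Q : Type*} (D : DetAut σ Q) (q : Q) : Set (List σ) :=
  {w | dfaRun D w q ∈ D.acc}

/-- The language accepted by `D`. -/
def dfaLang {σ Q : Type*} (D : DetAut σ Q) : Set (List σ) :=
  dfaLangFrom D D.init

/-- The states of the reachable subset construction of the nfa `M`:
the subsets of states of the form `M_u[I_M]`. -/
def ReachSubset {σ Z : Type*} (M : RelNFA σ Z) : Type _ :=
  {S : Set Z // ∃ u : List σ, S = M.imgSet u M.I}

/-- The reachable subset construction of an nfa `M`: a dfa whose states are the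
reachable subsets `M_u[I_M]`, with transitions `S ↦ M_a[S]`, initial state
`I_M` and final states those subsets meeting `F_M`. -/
def rsc {σ Z : Type*} (M : RelNFA σ Z) : DetAut σ (ReachSubset M) where
  init := ⟨M.I, [], (M.imgSet_nil M.I).symm⟩
  next := fun a S => ⟨{z' | ∃ z ∈ S.1, M.tr a z z'}, by
    obtain ⟨u, hu⟩ := S.2
    exact ⟨u ++ [a], by rw [M.imgSet_append_singleton, ← hu]⟩⟩
  acc := {S | (S.1 ∩ M.F).Nonempty}

/-- A dfa viewed as a relational nfa. -/
def dfaToNFA {σ Q : Type*} (D : DetAut σ Q) : RelNFA σ Q where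
  I := {D.init}
  F := D.acc
  tr := fun a q q' => D.next a q = q'

/-- Left quotient of a language by a single word: `u⁻¹L = {w : u++w ∈ L}`. -/
def leftQuot {σ : Type*} (u : List σ) (L : Set (List σ)) : Set (List σ) :=
  {w | u ++ w ∈ L}

/-- The states of the state-minimal dfa of `L`: the left word quotients of `L`. -/
def MinState {σ : Type*} (L : Set (List σ)) : Type _ :=
  {Y : Set (List σ) // ∃ u : List σ, Y = leftQuot u L}

/-- The state-minimal dfa of `L`: states are the left word quotients of `L`,
initial state `L`, `a`-transitions `X ↦ a⁻¹X`, final states `{X : ε ∈ X}`. -/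
def minDfa {σ : Type*} (L : Set (List σ)) : DetAut σ (MinState L) where
  init := ⟨L, [], by ext w; simp [leftQuot]⟩
  next := fun a Y => ⟨{w | a :: w ∈ Y.1}, by
    obtain ⟨u, hu⟩ := Y.2
    refine ⟨u ++ [a], ?_⟩
    rw [hu]
    ext w
    simp [leftQuot, List.append_assoc]⟩
  acc := {Y | ([] : List σ) ∈ Y.1}

namespace RelNFA

variable {σ Z : Type*}

theorem runRel_append (N : RelNFA σ Z) (u v : List σ) (z z' : Z) :
    N.runRel (u ++ v) z z' ↔ ∃ y, N.runRel u z y ∧ N.runRel v y z' := by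
  induction v using List.reverseRecOn generalizing z' with
  | nil => simp [runRel_nil]
  | append_singleton v a ih =>
    rw [← List.append_assoc]
    simp only [runRel_append_singleton, ih]
    tauto

theorem runRel_singleton (N : RelNFA σ Z) (a : σ) (z z' : Z) :
    N.runRel [a] z z' ↔ N.tr a z z' := by
  simp [runRel]

theorem rev_runRel (N : RelNFA σ Z) (w : List σ) (z z' : Z) :
    N.rev.runRel w z z' ↔ N.runRel w.reverse z' z := by
  induction w using List.reverseRecOn generalizing z' with
  | nil => simp [runRel_nil, eq_comm]
  | append_singleton w a ih =>
    rw [List.reverse_append, runRel_append_singleton, runRel_append]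
    simp only [ih, List.reverse_singleton, runRel_singleton]
    exact exists_congr fun _ => and_comm

theorem mem_lang (N : RelNFA σ Z) (w : List σ) :
    w ∈ N.lang ↔ ∃ z ∈ N.I, ∃ z' ∈ N.F, N.runRel w z z' := by
  simp only [lang, imgSet, Set.Nonempty, Set.mem_inter_iff, Set.mem_ofPred_eq]
  tauto

theorem mem_rev_lang (N : RelNFA σ Z) (w : List σ) :
    w ∈ N.rev.lang ↔ w.reverse ∈ N.lang := by
  simp only [mem_lang, rev_runRel]
  constructor <;> exact fun ⟨z, hz, z', hz', h⟩ => ⟨z', hz', z, hz, h⟩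

end RelNFA

theorem dfaRun_append_singleton {σ Q : Type*} (D : DetAut σ Q) (w : List σ) (a : σ) (q : Q) :
    dfaRun D (w ++ [a]) q = D.next a (dfaRun D w q) := by
  simp [dfaRun]

theorem dfaToNFA_runRel {σ Q : Type*} (D : DetAut σ Q) (w : List σ) (q q' : Q) :
    (dfaToNFA D).runRel w q q' ↔ dfaRun D w q = q' := by
  induction w using List.reverseRecOn generalizing q' with
  | nil => rfl
  | append_singleton w a ih =>
    simp only [RelNFA.runRel_append_singleton, dfaRun_append_singleton, ih]
    simp [dfaToNFA]

theorem dfaToNFA_lang {σ Q : Type*} (D : DetAut σ Q) : (dfaToNFA D).lang = dfaLang D := by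
  ext w
  simp only [RelNFA.mem_lang, dfaToNFA_runRel]
  simp [dfaToNFA, dfaLang, dfaLangFrom]

theorem dfaRun_rsc_val {σ Z : Type*} (M : RelNFA σ Z) (w : List σ) (q : ReachSubset M) :
    (dfaRun (rsc M) w q).1 = M.imgSet w q.1 := by
  induction w using List.reverseRecOn with
  | nil => exact (M.imgSet_nil q.1).symm
  | append_singleton w a ih =>
    rw [dfaRun_append_singleton, M.imgSet_append_singleton, ← ih]
    rfl

theorem exists_dfaRun_rsc_init_eq {σ Z : Type*} (M : RelNFA σ Z) (q : ReachSubset M) :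
    ∃ u, dfaRun (rsc M) u (rsc M).init = q := by
  obtain ⟨u, hu⟩ := q.2
  exact ⟨u, Subtype.ext ((dfaRun_rsc_val M u _).trans hu.symm)⟩

theorem mem_dfaLangFrom_rsc {σ Z : Type*} (M : RelNFA σ Z) (q : ReachSubset M) (w : List σ) :
    w ∈ dfaLangFrom (rsc M) q ↔ (M.imgSet w q.1 ∩ M.F).Nonempty := by
  rw [← dfaRun_rsc_val]
  rfl

theorem dfaLang_rsc {σ Z : Type*} (M : RelNFA σ Z) : dfaLang (rsc M) = M.lang :=
  Set.ext (mem_dfaLangFrom_rsc M (rsc M).init)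

theorem dfaLangFrom_dfaRun_init {σ Q : Type*} (D : DetAut σ Q) (u : List σ) :
    dfaLangFrom D (dfaRun D u D.init) = leftQuot u (dfaLang D) := by
  ext w
  simp [dfaLangFrom, dfaLang, leftQuot, dfaRun]

theorem mem_dfaLangFrom_rsc_rev {σ Q : Type*} (D : DetAut σ Q)
    (S : ReachSubset (dfaToNFA D).rev) (w : List σ) :
    w ∈ dfaLangFrom (rsc (dfaToNFA D).rev) S ↔ dfaRun D w.reverse D.init ∈ S.1 := by
  simp only [mem_dfaLangFrom_rsc, RelNFA.imgSet, RelNFA.rev_runRel, dfaToNFA_runRel]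
  simp [Set.Nonempty, RelNFA.rev, dfaToNFA]

theorem dfaLangFrom_rsc_rev_injective {σ Q : Type*} (D : DetAut σ Q)
    (hD : ∀ q, ∃ u, dfaRun D u D.init = q) :
    Function.Injective (dfaLangFrom (rsc (dfaToNFA D).rev)) := by
  intro S T h
  refine Subtype.ext (Set.ext fun q => ?_)
  obtain ⟨u, rfl⟩ := hD q
  simpa only [mem_dfaLangFrom_rsc_rev, List.reverse_reverse] using Set.ext_iff.mp h u.reverse

theorem dfaLang_rsc_rev_rsc_rev {σ Z : Type*} (N : RelNFA σ Z) :
    dfaLang (rsc (dfaToNFA (rsc N.rev)).rev) = N.lang := by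
  ext w
  rw [dfaLang_rsc, RelNFA.mem_rev_lang, dfaToNFA_lang, dfaLang_rsc, RelNFA.mem_rev_lang,
    List.reverse_reverse]

/-- Brzozowski's construction: determinize the reverse of `N` (obtaining `D₁`),
then determinize the reverse of `D₁` (obtaining `D₂`).  Then `D₂` accepts
`L := L(N)`, distinct states of `D₂` accept distinct languages, and sending a
state of `D₂` to the language it accepts is a dfa isomorphism onto the
state-minimal dfa of `L`. -/
theorem brzozowski {σ Z : Type*} [Fintype Z] (N : RelNFA σ Z) :
    dfaLang (rsc (dfaToNFA (rsc N.rev)).rev) = N.lang ∧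
    (∀ q q' : ReachSubset (dfaToNFA (rsc N.rev)).rev,
      dfaLangFrom (rsc (dfaToNFA (rsc N.rev)).rev) q =
        dfaLangFrom (rsc (dfaToNFA (rsc N.rev)).rev) q' → q = q') ∧
    ∃ f : ReachSubset (dfaToNFA (rsc N.rev)).rev → MinState N.lang,
      Function.Bijective f ∧
      f (rsc (dfaToNFA (rsc N.rev)).rev).init = (minDfa N.lang).init ∧
      (∀ (a : σ) (q : ReachSubset (dfaToNFA (rsc N.rev)).rev),
        f ((rsc (dfaToNFA (rsc N.rev)).rev).next a q) = (minDfa N.lang).next a (f q)) ∧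
      (∀ q : ReachSubset (dfaToNFA (rsc N.rev)).rev,
        q ∈ (rsc (dfaToNFA (rsc N.rev)).rev).acc ↔ f q ∈ (minDfa N.lang).acc) ∧
      (∀ q : ReachSubset (dfaToNFA (rsc N.rev)).rev,
        (f q).1 = dfaLangFrom (rsc (dfaToNFA (rsc N.rev)).rev) q) := by
  have hL := dfaLang_rsc_rev_rsc_rev N
  have hinj := dfaLangFrom_rsc_rev_injective (rsc N.rev) (exists_dfaRun_rsc_init_eq N.rev)
  refine ⟨hL, fun _ _ h => hinj h, fun q => ⟨dfaLangFrom _ q, ?_⟩, ⟨?_, ?_⟩, Subtype.ext hL,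
    fun _ _ => rfl, fun _ => Iff.rfl, fun _ => rfl⟩
  · obtain ⟨u, rfl⟩ := exists_dfaRun_rsc_init_eq _ q
    exact ⟨u, by rw [dfaLangFrom_dfaRun_init, hL]⟩
  · exact fun _ _ h => hinj (congrArg Subtype.val h)
  · rintro ⟨_, u, rfl⟩
    exact ⟨dfaRun _ u (rsc _).init, Subtype.ext ((dfaLangFrom_dfaRun_init _ u).trans (by rw [hL]))⟩
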